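/- arXiv:math-ph/0605080 — 7 statements merged into one kernel-verified Lean document; each statement's English description precedes it below -/
import Mathlib

section
/- For all s, s₀ ∈ [0,L] one has | ‖γ(s) − γ(s₀)‖ − |s−s₀| | ≤ (K/2)·(s−s₀)². (Chord length versus arc length, from the proof of Lemma 6.2 of the paper.) -/
open Set

/-- First-order Taylor estimate: if the second derivative of `f` is bounded by `K` on `[a, b]`,
the error of the linear approximation of `f` at `a` is at most `K / 2 * (b - a) ^ 2`. -/
theorem norm_sub_sub_smul_le_of_norm_second_deriv_le {E : Type*} [NormedAddCommGroup E]
    [NormedSpace ℝ E] {f f' f'' : ℝ → E} {a b K : ℝ} (hab : a ≤ b)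
    (hf : ∀ x ∈ Icc a b, HasDerivWithinAt f (f' x) (Icc a b) x)
    (hf' : ∀ x ∈ Icc a b, HasDerivWithinAt f' (f'' x) (Icc a b) x)
    (hK : ∀ x ∈ Icc a b, ‖f'' x‖ ≤ K) :
    ‖f b - f a - (b - a) • f' a‖ ≤ K / 2 * (b - a) ^ 2 := by
  have hlip : ∀ x ∈ Icc a b, ‖f' x - f' a‖ ≤ K * (x - a) :=
    norm_image_sub_le_of_norm_deriv_le_segment' hf' fun x hx => hK x (Ico_subset_Icc_self hx)
  have hderiv : ∀ x ∈ Icc a b, HasDerivWithinAt (fun x => f x - f a - (x - a) • f' a)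
      (f' x - f' a) (Icc a b) x := fun x hx => by
    simpa using! ((hf x hx).sub_const (f a)).sub
      (((hasDerivWithinAt_id x (Icc a b)).sub_const a).smul_const (f' a))
  have hbound : ∀ x, HasDerivAt (fun x => K / 2 * (x - a) ^ 2) (K * (x - a)) x := fun x => by
    refine ((((hasDerivAt_id' x).sub_const a).pow 2).const_mul (K / 2)).congr_deriv ?_
    ring
  exact image_norm_le_of_norm_deriv_right_le_deriv_boundary
    (fun x hx => (hderiv x hx).continuousWithinAt)
    (fun x hx => (hderiv x (Ico_subset_Icc_self hx)).mono_of_mem_nhdsWithin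
      (Icc_mem_nhdsGE_of_mem hx))
    (by simp) hbound (fun x hx => hlip x (Ico_subset_Icc_self hx)) (right_mem_Icc.2 hab)


/-- Chord length versus arc length: for all `s, s₀ ∈ [0,L]`,
`| ‖γ(s) − γ(s₀)‖ − |s−s₀| | ≤ (K/2)·(s−s₀)²`. -/
theorem chord_length_vs_arc_length
    (L K : ℝ) (hL : 0 < L) (hK : 0 ≤ K)
    (γ γ' γ'' : ℝ → EuclideanSpace ℝ (Fin 2))
    (hd1 : ∀ s ∈ Icc (0:ℝ) L, HasDerivWithinAt γ (γ' s) (Icc (0:ℝ) L) s)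
    (hd2 : ∀ s ∈ Icc (0:ℝ) L, HasDerivWithinAt γ' (γ'' s) (Icc (0:ℝ) L) s)
    (hcont : ContinuousOn γ'' (Icc (0:ℝ) L))
    (harc : ∀ s ∈ Icc (0:ℝ) L, ‖γ' s‖ = 1)
    (hcurv : ∀ s ∈ Icc (0:ℝ) L, ‖γ'' s‖ ≤ K) :
    ∀ s ∈ Icc (0:ℝ) L, ∀ s₀ ∈ Icc (0:ℝ) L,
      abs (‖γ s - γ s₀‖ - |s - s₀|) ≤ K / 2 * (s - s₀) ^ 2 := by
  intro s hs s₀ hs₀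
  wlog h : s₀ ≤ s generalizing s s₀
  · have := this s₀ hs₀ s hs (le_of_not_ge h)
    rwa [norm_sub_rev, abs_sub_comm s, ← neg_sub s₀ s, neg_sq]
  have hsub : Icc s₀ s ⊆ Icc 0 L := Icc_subset_Icc hs₀.1 hs.2
  have htaylor := norm_sub_sub_smul_le_of_norm_second_deriv_le h
    (fun x hx => (hd1 x (hsub hx)).mono hsub) (fun x hx => (hd2 x (hsub hx)).mono hsub)
    fun x hx => hcurv x (hsub hx)
  have htangent : ‖(s - s₀) • γ' s₀‖ = |s - s₀| := by
    rw [norm_smul, harc s₀ hs₀, mul_one, Real.norm_eq_abs]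
  rw [← htangent]
  exact (abs_norm_sub_norm_le _ _).trans htaylor
end

section
/- For all s, s₀ ∈ [0,L] with 0 < |s−s₀| ≤ m one has ‖ (γ(s) − γ(s₀))/‖γ(s) − γ(s₀)‖ − sgn(s−s₀)·γ'(s₀) ‖ ≤ K·|s−s₀|, where sgn(t) = 1 for t > 0 and sgn(t) = −1 for t < 0. (The normalized chord vector is close to the unit tangent vector; from the proof of Lemma 6.2 of the paper.) -/
open Set

/-- First-order Taylor estimate on `[0, d]` for a map into a normed space whose derivative
grows at most linearly away from its initial value. -/
theorem norm_sub_sub_smul_le_of_norm_deriv_sub_le {E : Type*} [NormedAddCommGroup E]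
    [NormedSpace ℝ E] {g g' : ℝ → E} {d K : ℝ} (hd : 0 ≤ d)
    (hg : ∀ t ∈ Icc 0 d, HasDerivWithinAt g (g' t) (Icc 0 d) t)
    (hK : ∀ t ∈ Icc 0 d, ‖g' t - g' 0‖ ≤ K * t) :
    ‖g d - g 0 - d • g' 0‖ ≤ K * d ^ 2 / 2 := by
  have hf : ∀ t ∈ Icc 0 d,
      HasDerivWithinAt (fun t => g t - g 0 - t • g' 0) (g' t - g' 0) (Icc 0 d) t := by
    intro t ht
    have hsmul : HasDerivWithinAt (fun t : ℝ => t • g' 0) (g' 0) (Icc 0 d) t := by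
      simpa using (hasDerivWithinAt_id t (Icc 0 d)).smul_const (g' 0)
    exact ((hg t ht).sub_const (g 0)).sub hsmul
  refine image_norm_le_of_norm_deriv_right_le_deriv_boundary
    (f := fun t => g t - g 0 - t • g' 0) (f' := fun t => g' t - g' 0)
    (B := fun t => K * t ^ 2 / 2) (B' := fun t => K * t)
    (fun t ht => (hf t ht).continuousWithinAt)
    (fun t ht => ((hf t (Ico_subset_Icc_self ht)).mono_of_mem_nhdsWithin
      (Icc_mem_nhdsGE_of_mem ht)))
    (by simp) (fun t => ?_) (fun t ht => hK t (Ico_subset_Icc_self ht)) (right_mem_Icc.2 hd)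
  refine (((hasDerivAt_pow 2 t).const_mul K).div_const 2).congr_deriv ?_
  norm_num
  ring

/-- Normalizing a vector at most doubles its distance to a given unit vector. -/
theorem norm_inv_norm_smul_sub_le {E : Type*} [NormedAddCommGroup E] [NormedSpace ℝ E]
    (v : E) {u : E} (hu : ‖u‖ = 1) : ‖‖v‖⁻¹ • v - u‖ ≤ 2 * ‖v - u‖ := by
  rcases eq_or_ne v 0 with rfl | hv
  · simp [hu]
  have hv' : ‖v‖ ≠ 0 := norm_ne_zero_iff.2 hv
  have h : ‖‖v‖⁻¹ • v - v‖ = |‖u‖ - ‖v‖| := by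
    have hfactor : ‖v‖⁻¹ • v - v = (‖v‖⁻¹ - 1) • v := by rw [sub_smul, one_smul]
    have hmul : 1 - ‖v‖ = (‖v‖⁻¹ - 1) * ‖v‖ := by rw [sub_mul, inv_mul_cancel₀ hv', one_mul]
    rw [hu, hfactor, hmul, norm_smul, abs_mul, abs_norm, Real.norm_eq_abs]
  calc ‖‖v‖⁻¹ • v - u‖ ≤ ‖‖v‖⁻¹ • v - v‖ + ‖v - u‖ := norm_sub_le_norm_sub_add_norm_sub _ _ _
    _ ≤ 2 * ‖v - u‖ := by
      rw [h, norm_sub_rev v u]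
      linarith [abs_norm_sub_norm_le u v]

/-- The normalized chord vector is close to the unit tangent vector:
for `0 < |s−s₀| ≤ m`,
`‖ (γ(s)−γ(s₀))/‖γ(s)−γ(s₀)‖ − sgn(s−s₀)·γ'(s₀) ‖ ≤ K·|s−s₀|`. -/
theorem normalized_chord_close_to_tangent
    (L K : ℝ) (hL : 0 < L) (hK : 0 ≤ K)
    (γ γ' γ'' : ℝ → EuclideanSpace ℝ (Fin 2))
    (hd1 : ∀ s ∈ Icc (0:ℝ) L, HasDerivWithinAt γ (γ' s) (Icc (0:ℝ) L) s)
    (hd2 : ∀ s ∈ Icc (0:ℝ) L, HasDerivWithinAt γ' (γ'' s) (Icc (0:ℝ) L) s)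
    (hcont : ContinuousOn γ'' (Icc (0:ℝ) L))
    (harc : ∀ s ∈ Icc (0:ℝ) L, ‖γ' s‖ = 1)
    (hcurv : ∀ s ∈ Icc (0:ℝ) L, ‖γ'' s‖ ≤ K)
    (m M : ℝ) (hm0 : 0 < m) (hmL : m ≤ L) (hM : 0 < M)
    (hchord : ∀ s ∈ Icc (0:ℝ) L, ∀ s' ∈ Icc (0:ℝ) L,
      |s - s'| ≤ m → M * |s - s'| ≤ ‖γ s - γ s'‖) :
    ∀ s ∈ Icc (0:ℝ) L, ∀ s₀ ∈ Icc (0:ℝ) L, 0 < |s - s₀| → |s - s₀| ≤ m →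
      ‖‖γ s - γ s₀‖⁻¹ • (γ s - γ s₀) - Real.sign (s - s₀) • γ' s₀‖ ≤ K * |s - s₀| := by
  intro s hs s₀ hs₀ hpos _
  set d := |s - s₀|
  set σ := Real.sign (s - s₀)
  have hne : s - s₀ ≠ 0 := abs_pos.1 hpos
  have hσ : |σ| = 1 := by
    rcases Real.sign_apply_eq_of_ne_zero _ hne with h | h <;> simp [σ, h]
  have hσd : s₀ + σ * d = s := by
    rcases lt_or_gt_of_ne hne with h | h
    · simp only [σ, d, Real.sign_of_neg h, abs_of_neg h]
      ring
    · simp only [σ, d, Real.sign_of_pos h, abs_of_pos h]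
      ring
  have hmaps : MapsTo (fun t => s₀ + σ * t) (Icc 0 d) (Icc 0 L) := by
    intro t ht
    have hmem := (convex_Icc (0 : ℝ) L).add_smul_sub_mem hs₀ hs
      (t := t / d) ⟨div_nonneg ht.1 hpos.le, (div_le_one hpos).2 ht.2⟩
    have heq : s₀ + (t / d) • (s - s₀) = s₀ + σ * t := by
      rw [← hσd, smul_eq_mul]
      field_simp
      ring
    rwa [heq] at hmem
  have hline : ∀ t, HasDerivWithinAt (fun t => s₀ + σ * t) σ (Icc 0 d) t := fun t => by
    simpa using (((hasDerivAt_id t).const_mul σ).const_add s₀).hasDerivWithinAt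
  have htaylor : ‖γ s - γ s₀ - d • σ • γ' s₀‖ ≤ K * d ^ 2 / 2 := by
    have h := norm_sub_sub_smul_le_of_norm_deriv_sub_le (g := fun t => γ (s₀ + σ * t))
      (g' := fun t => σ • γ' (s₀ + σ * t)) (K := K) hpos.le
      (fun t ht => (hd1 _ (hmaps ht)).scomp t (hline t) hmaps) (fun t ht => by
        have hlip := (convex_Icc (0 : ℝ) L).norm_image_sub_le_of_norm_hasDerivWithin_le
          hd2 hcurv hs₀ (hmaps ht)
        simpa [← smul_sub, norm_smul, hσ, abs_of_nonneg ht.1] using hlip)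
    simpa [hσd] using h
  have hunit : ‖σ • γ' s₀‖ = 1 := by
    rw [norm_smul, Real.norm_eq_abs, hσ, harc s₀ hs₀, one_mul]
  have hscale : ‖d⁻¹ • (γ s - γ s₀)‖⁻¹ • d⁻¹ • (γ s - γ s₀)
      = ‖γ s - γ s₀‖⁻¹ • (γ s - γ s₀) := by
    rw [norm_smul, norm_inv, Real.norm_eq_abs, abs_of_pos hpos, smul_smul, mul_inv, inv_inv]
    congr 1
    field_simp
  have hdist : d⁻¹ • (γ s - γ s₀) - σ • γ' s₀ = d⁻¹ • (γ s - γ s₀ - d • σ • γ' s₀) := by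
    rw [smul_sub d⁻¹ (γ s - γ s₀), inv_smul_smul₀ hpos.ne']
  calc ‖‖γ s - γ s₀‖⁻¹ • (γ s - γ s₀) - σ • γ' s₀‖
      ≤ 2 * ‖d⁻¹ • (γ s - γ s₀) - σ • γ' s₀‖ := by
        rw [← hscale]
        exact norm_inv_norm_smul_sub_le _ hunit
    _ = 2 * (d⁻¹ * ‖γ s - γ s₀ - d • σ • γ' s₀‖) := by
        rw [hdist, norm_smul, norm_inv, Real.norm_eq_abs, abs_of_pos hpos]
    _ ≤ 2 * (d⁻¹ * (K * d ^ 2 / 2)) := by gcongr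
    _ = K * d := by field_simp
end

section
/- Let δ ∈ (0,L] and let y ∈ ℝ² satisfy ‖y − γ(s_y)‖ ≤ M·δ/2. Then (1/(2π)) · ∫ over {s ∈ [0,L] : |s−s_y| ≥ δ} of ds/‖y − γ(s)‖ ≤ (2/(π·M)) · ( log L + |log δ| ). (Lemma 6.4 (ii) of the paper.) -/
open Set MeasureTheory Real

/-- A kernel `1 / |s - c|` integrates to `log (L / δ)` on the right shell `[c + δ, c + L]`. -/
lemma integrableOn_and_integral_inv_abs_sub_right {c δ L : ℝ} (hδ : 0 < δ) (hL : δ ≤ L) :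
    IntegrableOn (fun s : ℝ => |s - c|⁻¹) (Icc (c + δ) (c + L)) ∧
      ∫ s in Icc (c + δ) (c + L), |s - c|⁻¹ = Real.log (L / δ) := by
  constructor
  · refine ContinuousOn.integrableOn_Icc (ContinuousOn.inv₀ (by fun_prop) fun s hs => ?_)
    exact abs_ne_zero.2 (by linarith [hs.1])
  · have h : EqOn (fun s : ℝ => |s - c|⁻¹) (fun s => (s - c)⁻¹) (Icc (c + δ) (c + L)) :=
      fun s hs => by simp only [abs_of_pos (show 0 < s - c by linarith [hs.1])]
    rw [setIntegral_congr_fun measurableSet_Icc h, integral_Icc_eq_integral_Ioc,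
      ← intervalIntegral.integral_of_le (by linarith),
      intervalIntegral.integral_comp_sub_right (fun x => x⁻¹) c, add_sub_cancel_left,
      add_sub_cancel_left, integral_inv_of_pos hδ (hδ.trans_le hL)]

/-- A kernel `1 / |s - c|` integrates to `log (L / δ)` on the left shell `[c - L, c - δ]`. -/
lemma integrableOn_and_integral_inv_abs_sub_left {c δ L : ℝ} (hδ : 0 < δ) (hL : δ ≤ L) :
    IntegrableOn (fun s : ℝ => |s - c|⁻¹) (Icc (c - L) (c - δ)) ∧
      ∫ s in Icc (c - L) (c - δ), |s - c|⁻¹ = Real.log (L / δ) := by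
  constructor
  · refine ContinuousOn.integrableOn_Icc (ContinuousOn.inv₀ (by fun_prop) fun s hs => ?_)
    exact abs_ne_zero.2 (by linarith [hs.2])
  · have h : EqOn (fun s : ℝ => |s - c|⁻¹) (fun s => (c - s)⁻¹) (Icc (c - L) (c - δ)) :=
      fun s hs => by
        simp only [abs_of_neg (show s - c < 0 by linarith [hs.2]), neg_sub]
    rw [setIntegral_congr_fun measurableSet_Icc h, integral_Icc_eq_integral_Ioc,
      ← intervalIntegral.integral_of_le (by linarith),
      intervalIntegral.integral_comp_sub_left (fun x => x⁻¹) c, sub_sub_cancel,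
      sub_sub_cancel, integral_inv_of_pos hδ (hδ.trans_le hL)]

/-- Lemma 6.4 (ii) of the paper: if `‖y − γ(s_y)‖ ≤ M·δ/2` then
`(1/2π) ∫_{|s−s_y| ≥ δ, s ∈ [0,L]} ds/‖y−γ(s)‖ ≤ (2/(πM))·(log L + |log δ|)`. -/
theorem integral_away_from_foot_log_bound
    (L K : ℝ) (hL : 0 < L) (hK : 0 ≤ K)
    (γ γ' γ'' : ℝ → EuclideanSpace ℝ (Fin 2))
    (hd1 : ∀ s ∈ Icc (0:ℝ) L, HasDerivWithinAt γ (γ' s) (Icc (0:ℝ) L) s)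
    (hd2 : ∀ s ∈ Icc (0:ℝ) L, HasDerivWithinAt γ' (γ'' s) (Icc (0:ℝ) L) s)
    (hcont : ContinuousOn γ'' (Icc (0:ℝ) L))
    (harc : ∀ s ∈ Icc (0:ℝ) L, ‖γ' s‖ = 1)
    (hcurv : ∀ s ∈ Icc (0:ℝ) L, ‖γ'' s‖ ≤ K)
    (M : ℝ) (hM : 0 < M)
    (hchord : ∀ s ∈ Icc (0:ℝ) L, ∀ s' ∈ Icc (0:ℝ) L, M * |s - s'| ≤ ‖γ s - γ s'‖)
    (s_y : ℝ) (hsy : s_y ∈ Icc (0:ℝ) L)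
    (δ : ℝ) (hδ0 : 0 < δ) (hδL : δ ≤ L)
    (y : EuclideanSpace ℝ (Fin 2)) (hy : ‖y - γ s_y‖ ≤ M * δ / 2) :
    (1 / (2 * π)) *
        ∫ s in {s : ℝ | s ∈ Icc (0:ℝ) L ∧ δ ≤ |s - s_y|}, 1 / ‖y - γ s‖
      ≤ (2 / (π * M)) * (Real.log L + |Real.log δ|) := by
  set S := {s : ℝ | s ∈ Icc (0:ℝ) L ∧ δ ≤ |s - s_y|}
  obtain ⟨hl, hl'⟩ := integrableOn_and_integral_inv_abs_sub_left (c := s_y) hδ0 hδL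
  obtain ⟨hr, hr'⟩ := integrableOn_and_integral_inv_abs_sub_right (c := s_y) hδ0 hδL
  have hSm : MeasurableSet S :=
    measurableSet_Icc.inter
      (isClosed_le continuous_const (by fun_prop : Continuous fun s : ℝ => |s - s_y|)).measurableSet
  have hsub : S ⊆ Icc (s_y - L) (s_y - δ) ∪ Icc (s_y + δ) (s_y + L) := by
    rintro s ⟨⟨h0, h1⟩, h2⟩
    rcases le_abs.1 h2 with h | h
    · exact Or.inr ⟨by linarith, by linarith [hsy.1]⟩
    · exact Or.inl ⟨by linarith [hsy.2], by linarith⟩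
  have hdisj : Disjoint (Icc (s_y - L) (s_y - δ)) (Icc (s_y + δ) (s_y + L)) :=
    Set.disjoint_left.2 fun s hs ht => by linarith [hs.2, ht.1]
  have hbound : ∀ s ∈ S, 1 / ‖y - γ s‖ ≤ 2 / M * |s - s_y|⁻¹ := by
    rintro s ⟨hs, hδs⟩
    have hpos : 0 < |s - s_y| := hδ0.trans_le hδs
    have htri : ‖γ s - γ s_y‖ ≤ ‖y - γ s‖ + ‖y - γ s_y‖ := by
      rw [norm_sub_rev y (γ s)]
      exact norm_sub_le_norm_sub_add_norm_sub _ _ _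
    have hlow : M * |s - s_y| / 2 ≤ ‖y - γ s‖ := by
      have := hchord s hs s_y hsy
      have := mul_le_mul_of_nonneg_left hδs hM.le
      linarith
    calc 1 / ‖y - γ s‖ ≤ 1 / (M * |s - s_y| / 2) :=
          one_div_le_one_div_of_le (by positivity) hlow
      _ = 2 / M * |s - s_y|⁻¹ := by field_simp
  have hint : ∫ s in S, 1 / ‖y - γ s‖ ≤ 2 / M * (2 * Real.log (L / δ)) := by
    calc ∫ s in S, 1 / ‖y - γ s‖ ≤ ∫ s in S, 2 / M * |s - s_y|⁻¹ :=
          integral_mono_of_nonneg (ae_of_all _ fun s => by positivity)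
            (((hl.union hr).mono_set hsub).const_mul _)
            ((ae_restrict_iff' hSm).2 (ae_of_all _ hbound))
      _ = 2 / M * ∫ s in S, |s - s_y|⁻¹ := integral_const_mul _ _
      _ ≤ 2 / M * (2 * Real.log (L / δ)) := by
          refine mul_le_mul_of_nonneg_left ?_ (by positivity)
          refine (setIntegral_mono_set (hl.union hr) (ae_of_all _ fun s => by positivity)
            (ae_of_all _ hsub)).trans ?_
          rw [setIntegral_union hdisj measurableSet_Icc hl hr, hl', hr', two_mul]
  calc (1 / (2 * π)) * ∫ s in S, 1 / ‖y - γ s‖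
      ≤ (1 / (2 * π)) * (2 / M * (2 * Real.log (L / δ))) :=
        mul_le_mul_of_nonneg_left hint (by positivity)
    _ = (2 / (π * M)) * Real.log (L / δ) := by field_simp
    _ ≤ (2 / (π * M)) * (Real.log L + |Real.log δ|) := by
        refine mul_le_mul_of_nonneg_left ?_ (by positivity)
        rw [Real.log_div hL.ne' hδ0.ne']
        linarith [neg_abs_le (Real.log δ)]
end

section
/- Suppose v ∈ ℝ² is a point where ψ attains a positive global maximum (ψ(v) = sup ψ > 0) or a negative global minimum (ψ(v) = inf ψ < 0). Then v ∈ Γ. (Proposition 5.2 of the paper, first part: all maxima and minima of an eigenfunction with negative eigenvalue lie on the support of the singular interaction.) -/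
open Set Filter

/-- The Laplacian of `ψ : ℝ² → ℝ` at `x`: the sum of the two repeated second partial
derivatives (the trace of the second derivative). -/
noncomputable def planeLaplacian (ψ : EuclideanSpace ℝ (Fin 2) → ℝ)
    (x : EuclideanSpace ℝ (Fin 2)) : ℝ :=
  ∑ i : Fin 2,
    fderiv ℝ (fun z => fderiv ℝ ψ z (EuclideanSpace.single i (1:ℝ))) x
      (EuclideanSpace.single i (1:ℝ))

open Topology in
/-- Necessary second-order condition at a local maximum of a function of one real variable. -/
theorem IsLocalMax.deriv_deriv_nonpos {g : ℝ → ℝ} {a : ℝ} (hmax : IsLocalMax g a)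
    (hc : ContinuousAt g a) : deriv (deriv g) a ≤ 0 := by
  by_contra! hpos
  have hmin : IsLocalMin g a := isLocalMin_of_deriv_deriv_pos hpos hmax.deriv_eq_zero hc
  have hconst : g =ᶠ[𝓝 a] fun _ => g a := by
    filter_upwards [hmax, hmin] with t h₁ h₂ using le_antisymm h₁ h₂
  have hderiv := hconst.deriv.deriv_eq
  simp only [deriv_const'] at hderiv
  exact hpos.ne' hderiv

open Topology in
/-- At a local maximum of a `C²` function, every repeated directional second derivative is
nonpositive. -/
theorem IsLocalMax.fderiv_fderiv_apply_nonpos {E : Type*} [NormedAddCommGroup E]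
    [NormedSpace ℝ E] {f : E → ℝ} {x : E} (hmax : IsLocalMax f x) (hf : ContDiffAt ℝ 2 f x)
    (e : E) : fderiv ℝ (fun z => fderiv ℝ f z e) x e ≤ 0 := by
  have hline (t : ℝ) : HasDerivAt (fun t : ℝ => x + t • e) e t := by
    simpa using ((hasDerivAt_id t).smul_const e).const_add x
  have htend : Tendsto (fun t : ℝ => x + t • e) (𝓝 0) (𝓝 x) := by
    simpa using (hline 0).continuousAt.tendsto
  have hderiv : deriv (fun t : ℝ => f (x + t • e)) =ᶠ[𝓝 0]
      fun t => fderiv ℝ f (x + t • e) e := by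
    filter_upwards [htend.eventually (hf.eventually (by simp))] with t ht
    exact ((ht.differentiableAt (by simp)).hasFDerivAt.comp_hasDerivAt t (hline t)).deriv
  have hdiff : DifferentiableAt ℝ (fun z => fderiv ℝ f z e) x :=
    ((hf.fderiv_right (m := 1) (by norm_num)).differentiableAt (by simp)).clm_apply
      (differentiableAt_const e)
  have hsecond : deriv (deriv fun t : ℝ => f (x + t • e)) 0 =
      fderiv ℝ (fun z => fderiv ℝ f z e) x e := by
    rw [hderiv.deriv_eq]
    exact (hdiff.hasFDerivAt.comp_hasDerivAt_of_eq 0 (hline 0) (by simp)).deriv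
  rw [← hsecond]
  refine IsLocalMax.deriv_deriv_nonpos ?_ ?_
  · simpa [IsLocalMax, IsMaxFilter] using htend.eventually hmax
  · exact ContinuousAt.comp (by simpa using hf.continuousAt) (hline 0).continuousAt

/-- The Laplacian of a `C²` function is nonpositive at a local maximum. -/
theorem IsLocalMax.planeLaplacian_nonpos {ψ : EuclideanSpace ℝ (Fin 2) → ℝ}
    {x : EuclideanSpace ℝ (Fin 2)} (hmax : IsLocalMax ψ x) (hψ : ContDiffAt ℝ 2 ψ x) :
    planeLaplacian ψ x ≤ 0 :=
  Finset.sum_nonpos fun i _ => hmax.fderiv_fderiv_apply_nonpos hψ (EuclideanSpace.single i 1)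

theorem planeLaplacian_neg (ψ : EuclideanSpace ℝ (Fin 2) → ℝ) (x : EuclideanSpace ℝ (Fin 2)) :
    planeLaplacian (-ψ) x = -planeLaplacian ψ x := by
  simp [planeLaplacian, fderiv_neg, fderiv_fun_neg, add_comm]

/-- Proposition 5.2 of the paper, first part: every point where an eigenfunction with
negative eigenvalue attains a positive global maximum or a negative global minimum lies
on `Γ`. -/
theorem extrema_lie_on_support
    (Γ : Set (EuclideanSpace ℝ (Fin 2))) (hΓne : Γ.Nonempty) (hΓc : IsCompact Γ)
    (κ : ℝ) (hκ : 0 < κ)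
    (ψ : EuclideanSpace ℝ (Fin 2) → ℝ)
    (hψcont : Continuous ψ)
    (hψ0 : Tendsto ψ (cocompact (EuclideanSpace ℝ (Fin 2))) (nhds 0))
    (hψC2 : ContDiffOn ℝ 2 ψ Γᶜ)
    (heq : ∀ x ∉ Γ, planeLaplacian ψ x = κ ^ 2 * ψ x)
    (v : EuclideanSpace ℝ (Fin 2))
    (hv : ((∀ x, ψ x ≤ ψ v) ∧ 0 < ψ v) ∨ ((∀ x, ψ v ≤ ψ x) ∧ ψ v < 0)) :
    v ∈ Γ := by
  by_contra hvΓ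
  have hC2 : ContDiffAt ℝ 2 ψ v := hψC2.contDiffAt (hΓc.isClosed.isOpen_compl.mem_nhds hvΓ)
  have hv_eq := heq v hvΓ
  have hκ2 : 0 < κ ^ 2 := by positivity
  rcases hv with ⟨hmax, hpos⟩ | ⟨hmin, hneg⟩
  · have hle := IsLocalMax.planeLaplacian_nonpos (Eventually.of_forall hmax) hC2
    linarith [mul_pos hκ2 hpos]
  · have hle := IsLocalMax.planeLaplacian_nonpos (ψ := -ψ) (x := v)
      (Eventually.of_forall fun y => neg_le_neg (hmin y)) hC2.neg
    rw [planeLaplacian_neg] at hle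
    linarith [mul_neg_of_pos_of_neg hκ2 hneg]
end

section
/- Suppose ψ attains both a positive and a negative value on ℝ². Then ψ has a zero in the convex hull of Γ, i.e. there exists x in the convex hull of Γ with ψ(x) = 0. (Proposition 5.2 of the paper, second part.) -/
open Set Filter

/-- The second derivative of a function along a line is nonnegative at a local minimum. -/
theorem IsLocalMin.fderiv_fderiv_apply_nonneg {E : Type*} [NormedAddCommGroup E] [NormedSpace ℝ E]
    {f : E → ℝ} {x : E} (hmin : IsLocalMin f x) (hf : ContDiffAt ℝ 2 f x) (v : E) :
    0 ≤ fderiv ℝ (fun z => fderiv ℝ f z v) x v := by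
  have hline : ∀ t : ℝ, HasDerivAt (fun t : ℝ => x + t • v) v t := fun t => by
    simpa using ((hasDerivAt_id t).smul_const v).const_add x
  have hcont : Tendsto (fun t : ℝ => x + t • v) (nhds 0) (nhds x) := by
    simpa using (hline 0).continuousAt.tendsto
  have hdiff : ∀ᶠ z in nhds x, DifferentiableAt ℝ f z :=
    (hf.eventually (by simp)).mono fun z hz => hz.differentiableAt (by simp)
  have hdf : DifferentiableAt ℝ (fun z => fderiv ℝ f z v) x :=
    ((hf.fderiv_right (m := 1) (by norm_num)).differentiableAt (by simp)).clm_apply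
      (differentiableAt_const v)
  set g : ℝ → ℝ := fun t => f (x + t • v) with hg
  have hderiv : deriv g =ᶠ[nhds 0] fun t => fderiv ℝ f (x + t • v) v := by
    filter_upwards [hcont.eventually hdiff] with t ht
    exact (ht.hasFDerivAt.comp_hasDerivAt t (hline t)).deriv
  have hsecond : deriv (deriv g) 0 = fderiv ℝ (fun z => fderiv ℝ f z v) x v := by
    rw [hderiv.deriv_eq]
    have h : HasFDerivAt (fun z => fderiv ℝ f z v) (fderiv ℝ (fun z => fderiv ℝ f z v) x)
        (x + (0 : ℝ) • v) := by simpa using hdf.hasFDerivAt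
    exact (h.comp_hasDerivAt (0 : ℝ) (hline 0)).deriv
  have hgmin : IsLocalMin g 0 := by
    have h := hcont.eventually hmin
    simpa [IsLocalMin, IsMinFilter, hg] using h
  by_contra! hlt
  rw [← hsecond] at hlt
  have hgcont : ContinuousAt g 0 := by
    have h : ContinuousAt f (x + (0 : ℝ) • v) := by simpa using hf.continuousAt
    exact h.comp (f := fun t : ℝ => x + t • v) (hline 0).continuousAt
  have hgmax : IsLocalMax g 0 := isLocalMax_of_deriv_deriv_neg hlt hgmin.deriv_eq_zero hgcont
  have hconst : g =ᶠ[nhds 0] fun _ => g 0 := by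
    filter_upwards [hgmin, hgmax] with t h₁ h₂ using le_antisymm h₂ h₁
  have hzero : deriv (deriv g) 0 = 0 := by
    rw [hconst.deriv.deriv_eq]
    simp
  exact hlt.ne hzero

/-- Minimum principle: a decaying solution of `Δψ = κ²ψ` off `Γ` which takes a negative value
takes a negative value on `Γ`. -/
theorem exists_neg_mem_of_planeLaplacian_eq {Γ : Set (EuclideanSpace ℝ (Fin 2))}
    (hΓ : IsClosed Γ) {κ : ℝ} (hκ : 0 < κ) {ψ : EuclideanSpace ℝ (Fin 2) → ℝ}
    (hψcont : Continuous ψ)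
    (hψ0 : Tendsto ψ (cocompact (EuclideanSpace ℝ (Fin 2))) (nhds 0))
    (hψC2 : ContDiffOn ℝ 2 ψ Γᶜ)
    (heq : ∀ x ∉ Γ, planeLaplacian ψ x = κ ^ 2 * ψ x) (hneg : ∃ x, ψ x < 0) :
    ∃ x ∈ Γ, ψ x < 0 := by
  obtain ⟨y, hy⟩ := hneg
  obtain ⟨x, hx⟩ := hψcont.exists_forall_le' y
    ((hψ0.eventually (lt_mem_nhds hy)).mono fun _ h => h.le)
  have hxneg : ψ x < 0 := (hx y).trans_lt hy
  refine ⟨x, ?_, hxneg⟩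
  by_contra hxΓ
  have hmin : IsLocalMin ψ x := Eventually.of_forall hx
  have hC2 : ContDiffAt ℝ 2 ψ x := hψC2.contDiffAt (hΓ.isOpen_compl.mem_nhds hxΓ)
  have hnonneg : 0 ≤ planeLaplacian ψ x :=
    Finset.sum_nonneg fun i _ => hmin.fderiv_fderiv_apply_nonneg hC2 _
  rw [heq x hxΓ] at hnonneg
  exact (mul_neg_of_pos_of_neg (pow_pos hκ 2) hxneg).not_ge hnonneg

/-- Proposition 5.2 of the paper, second part: if the eigenfunction `ψ` attains both a
positive and a negative value, then it has a zero in the convex hull of `Γ`. -/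
theorem zero_in_convex_hull
    (Γ : Set (EuclideanSpace ℝ (Fin 2))) (hΓne : Γ.Nonempty) (hΓc : IsCompact Γ)
    (κ : ℝ) (hκ : 0 < κ)
    (ψ : EuclideanSpace ℝ (Fin 2) → ℝ)
    (hψcont : Continuous ψ)
    (hψ0 : Tendsto ψ (cocompact (EuclideanSpace ℝ (Fin 2))) (nhds 0))
    (hψC2 : ContDiffOn ℝ 2 ψ Γᶜ)
    (heq : ∀ x ∉ Γ, planeLaplacian ψ x = κ ^ 2 * ψ x)
    (hpos : ∃ x, 0 < ψ x) (hneg : ∃ x, ψ x < 0) :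
    ∃ x ∈ convexHull ℝ Γ, ψ x = 0 := by
  obtain ⟨a, ha, hψa⟩ :=
    exists_neg_mem_of_planeLaplacian_eq hΓc.isClosed hκ hψcont hψ0 hψC2 heq hneg
  obtain ⟨b, hb, hψb⟩ :=
    exists_neg_mem_of_planeLaplacian_eq (ψ := -ψ) hΓc.isClosed hκ hψcont.neg
      (neg_zero (G := ℝ) ▸ hψ0.neg) hψC2.neg
      (fun x hx => by simp [planeLaplacian_neg, heq x hx]) (by simpa using hpos)
  have hψb' : 0 < ψ b := by simpa using hψb
  exact (convex_convexHull ℝ Γ).isPreconnected.intermediate_value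
    (subset_convexHull ℝ Γ ha) (subset_convexHull ℝ Γ hb) hψcont.continuousOn
    ⟨hψa.le, hψb'.le⟩
end

section
/- Let x₀ ∈ ℝ², r > 0 and let y lie in the closed ball B̄(x₀,r). Then ∫_{B̄(x₀,r)} 1/(2π·‖x−y‖) dx ≤ 2r, where the integral is with respect to planar Lebesgue measure. (Estimate of the Newtonian-kernel integral over a ball, from the proof of Proposition 6.6 of the paper.) -/
open MeasureTheory Real

lemma id_mul_indicator_kernel_eqOn (R : ℝ) :
    Set.EqOn (fun t : ℝ => t ^ (2 - 1) • (Set.Iic R).indicator (fun s => 1 / (2 * π * s)) t)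
      ((Set.Iic R).indicator fun _ => (2 * π)⁻¹) (Set.Ioi 0) := by
  intro t ht
  have ht0 : t ≠ 0 := ne_of_gt ht
  by_cases hR : t ∈ Set.Iic R
  · simp only [Set.indicator_of_mem hR, smul_eq_mul]
    norm_num
    field_simp
  · simp [Set.indicator_of_notMem hR]

lemma indicator_kernel_comp_norm (R : ℝ) :
    (fun x : EuclideanSpace ℝ (Fin 2) => (Set.Iic R).indicator (fun s => 1 / (2 * π * s)) ‖x‖) =
      (Metric.closedBall (0 : EuclideanSpace ℝ (Fin 2)) R).indicator fun x => 1 / (2 * π * ‖x‖) := by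
  ext x
  by_cases hx : ‖x‖ ≤ R <;> simp [hx]

lemma integrableOn_newtonian_kernel_closedBall_zero (R : ℝ) :
    IntegrableOn (fun x : EuclideanSpace ℝ (Fin 2) => 1 / (2 * π * ‖x‖))
      (Metric.closedBall 0 R) := by
  rw [← integrable_indicator_iff measurableSet_closedBall, ← indicator_kernel_comp_norm,
    integrable_fun_norm_addHaar, finrank_euclideanSpace_fin,
    integrableOn_congr_fun (id_mul_indicator_kernel_eqOn R) measurableSet_Ioi,
    IntegrableOn, integrable_indicator_iff measurableSet_Iic, IntegrableOn,
    Measure.restrict_restrict measurableSet_Iic, Set.inter_comm, Set.Ioi_inter_Iic]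
  exact integrable_const _

lemma integral_newtonian_kernel_closedBall_zero {R : ℝ} (hR : 0 ≤ R) :
    ∫ x in Metric.closedBall (0 : EuclideanSpace ℝ (Fin 2)) R, 1 / (2 * π * ‖x‖) = R := by
  rw [← integral_indicator measurableSet_closedBall, ← indicator_kernel_comp_norm,
    integral_fun_norm_addHaar, finrank_euclideanSpace_fin,
    setIntegral_congr_fun measurableSet_Ioi (id_mul_indicator_kernel_eqOn R),
    integral_indicator measurableSet_Iic,
    Measure.restrict_restrict measurableSet_Iic, Set.inter_comm, Set.Ioi_inter_Iic]
  simp [measureReal_def, EuclideanSpace.volume_ball_fin_two, hR, pi_nonneg]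
  field_simp

/-- Estimate of the Newtonian-kernel integral over a ball: for `y` in the closed ball
`B̄(x₀,r)` one has `∫_{B̄(x₀,r)} dx/(2π‖x−y‖) ≤ 2r`. -/
theorem newtonian_kernel_integral_ball_bound
    (x₀ y : EuclideanSpace ℝ (Fin 2)) (r : ℝ) (hr : 0 < r)
    (hy : y ∈ Metric.closedBall x₀ r) :
    ∫ x in Metric.closedBall x₀ r, 1 / (2 * π * ‖x - y‖) ≤ 2 * r := by
  have hpre : (fun x => x - y) ⁻¹' Metric.closedBall 0 (2 * r) = Metric.closedBall y (2 * r) := by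
    ext x
    simp [dist_eq_norm]
  have hmp := measurePreserving_sub_right (volume : Measure (EuclideanSpace ℝ (Fin 2))) y
  have hemb : MeasurableEmbedding fun x => x - y := measurableEmbedding_subRight y
  have hsub : Metric.closedBall x₀ r ⊆ Metric.closedBall y (2 * r) := by
    apply Metric.closedBall_subset_closedBall'
    rw [dist_comm]
    linarith [Metric.mem_closedBall.mp hy]
  have hint : IntegrableOn (fun x => 1 / (2 * π * ‖x - y‖)) (Metric.closedBall y (2 * r)) := by
    rw [← hpre]
    exact (hmp.integrableOn_comp_preimage hemb).mpr
      (integrableOn_newtonian_kernel_closedBall_zero (2 * r))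
  calc
    _ ≤ ∫ x in Metric.closedBall y (2 * r), 1 / (2 * π * ‖x - y‖) :=
      setIntegral_mono_set hint (ae_of_all _ fun x => by positivity) hsub.eventuallyLE
    _ = ∫ x in Metric.closedBall (0 : EuclideanSpace ℝ (Fin 2)) (2 * r), 1 / (2 * π * ‖x‖) := by
      rw [← hpre]
      exact hmp.setIntegral_preimage_emb hemb (fun x => 1 / (2 * π * ‖x‖)) _
    _ = 2 * r := integral_newtonian_kernel_closedBall_zero (by positivity)
end

section
/- There exists β₀ > 0, depending only on C₁, C₅ and η₀, such that for every β ≥ β₀ and all α, c₃, c₄, L, κ₀, ρ > 0 one has ξ(b_β) ≤ 1/4. (Corollary A.2 of the paper.) -/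
noncomputable section

/-- `c₅ := max{2c₄, c₃ + c₄·log(max{1,L})}`. -/
def paperC5 (c₃ c₄ L : ℝ) : ℝ := max (2 * c₄) (c₃ + c₄ * Real.log (max 1 L))

/-- `ζ(κ₀) := 1` if `κ₀ ≥ 1/2` and `−log κ₀/log 2` otherwise. -/
def paperZeta (κ₀ : ℝ) : ℝ := if 1 / 2 ≤ κ₀ then 1 else -Real.log κ₀ / Real.log 2

/-- `T := C₁⁻¹·(c₅α+1)²·(κ₀²+1)/(κ₀ρ)`. -/
def paperT (C₁ α c₃ c₄ L κ₀ ρ : ℝ) : ℝ :=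
  C₁⁻¹ * (paperC5 c₃ c₄ L * α + 1) ^ 2 * (κ₀ ^ 2 + 1) / (κ₀ * ρ)

/-- `D := (1+√(2ρ))·e^{(η₀+2)ρ}`. -/
def paperD (η₀ ρ : ℝ) : ℝ := (1 + Real.sqrt (2 * ρ)) * Real.exp ((η₀ + 2) * ρ)

/-- `S := 2κ₀²(R+1) + C₅·ρ^{1/2}·e^ρ + α(c₃+c₄ log(max{1,L}))`, with `R = ρ/κ₀`. -/
def paperS (C₅ α c₃ c₄ L κ₀ ρ : ℝ) : ℝ :=
  2 * κ₀ ^ 2 * (ρ / κ₀ + 1) + C₅ * Real.sqrt ρ * Real.exp ρ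
    + α * (c₃ + c₄ * Real.log (max 1 L))

/-- `ξ(b) := b·(S + αc₄(|log b|+1))·T·D·(T·D+1)`. -/
def paperXi (C₁ C₅ η₀ α c₃ c₄ L κ₀ ρ b : ℝ) : ℝ :=
  b * (paperS C₅ α c₃ c₄ L κ₀ ρ + α * c₄ * (|Real.log b| + 1))
    * paperT C₁ α c₃ c₄ L κ₀ ρ * paperD η₀ ρ
    * (paperT C₁ α c₃ c₄ L κ₀ ρ * paperD η₀ ρ + 1)

/-- `b_β := (κ₀ρ)²ρ·e^{−βρ} / ((αc₅+1)⁶(κ₀²+1)⁴ζ(κ₀))`. -/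
def paperB (α c₃ c₄ L κ₀ ρ β : ℝ) : ℝ :=
  (κ₀ * ρ) ^ 2 * ρ * Real.exp (-β * ρ)
    / ((α * paperC5 c₃ c₄ L + 1) ^ 6 * (κ₀ ^ 2 + 1) ^ 4 * paperZeta κ₀)

end

theorem one_le_paperZeta {κ₀ : ℝ} (hκ : 0 < κ₀) : 1 ≤ paperZeta κ₀ := by
  unfold paperZeta
  split_ifs with h
  · exact le_rfl
  · have hlog2 : 0 < Real.log 2 := Real.log_pos (by norm_num)
    rw [le_div_iff₀ hlog2, one_mul, ← Real.log_inv]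
    apply Real.log_le_log (by norm_num)
    rw [le_inv_comm₀ (by norm_num) hκ]
    linarith

theorem abs_log_le_paperZeta {κ₀ : ℝ} (hκ : 0 < κ₀) :
    |Real.log κ₀| ≤ (κ₀ ^ 2 + 1) * paperZeta κ₀ := by
  have hlog2 : 0 < Real.log 2 := Real.log_pos (by norm_num)
  have hlog2' : Real.log 2 ≤ 1 := by linarith [Real.log_two_lt_d9]
  by_cases h : 1 / 2 ≤ κ₀
  · have h1 : Real.log κ₀ ≤ κ₀ - 1 := Real.log_le_sub_one_of_pos hκ
    have h2 : Real.log (1 / 2) ≤ Real.log κ₀ := Real.log_le_log (by norm_num) h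
    rw [one_div, Real.log_inv] at h2
    simp only [paperZeta, if_pos h, mul_one]
    rw [abs_le]
    constructor <;> nlinarith [sq_nonneg (κ₀ - 1)]
  · have hζ := one_le_paperZeta hκ
    have hneg : Real.log κ₀ < 0 := Real.log_neg hκ (by linarith)
    have heq : -Real.log κ₀ = paperZeta κ₀ * Real.log 2 := by
      simp only [paperZeta, if_neg h]
      field_simp
    rw [abs_of_neg hneg, heq]
    nlinarith [mul_nonneg (sq_nonneg κ₀) (zero_le_one.trans hζ)]

theorem sqrt_le_exp_self {x : ℝ} (hx : 0 ≤ x) : √x ≤ Real.exp x := by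
  nlinarith [Real.add_one_le_exp x, Real.sq_sqrt hx, sq_nonneg (√x - 1)]

theorem sqrt_mul_abs_log_le {x : ℝ} (hx : 0 < x) : √x * |Real.log x| ≤ 2 * (x + 1) := by
  have hs : 0 < √x := Real.sqrt_pos.mpr hx
  have hsq : √x * √x = x := Real.mul_self_sqrt hx.le
  have hlog : Real.log x = 2 * Real.log √x := by
    rw [Real.log_sqrt hx.le]; ring
  have h1 : Real.log √x ≤ √x - 1 := Real.log_le_sub_one_of_pos hs
  have h2 : -Real.log √x ≤ (√x)⁻¹ - 1 := by
    rw [← Real.log_inv]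
    exact Real.log_le_sub_one_of_pos (inv_pos.mpr hs)
  have h3 : |Real.log √x| ≤ √x + (√x)⁻¹ := by
    have : 0 < (√x)⁻¹ := inv_pos.mpr hs
    rw [abs_le]
    constructor <;> linarith
  rw [hlog, abs_mul, abs_two]
  calc √x * (2 * |Real.log √x|) ≤ √x * (2 * (√x + (√x)⁻¹)) := by gcongr
    _ = 2 * (√x * √x + √x * (√x)⁻¹) := by ring
    _ = 2 * (x + 1) := by rw [hsq, mul_inv_cancel₀ hs.ne']

/-- The prefactor of `ρ e^{-βρ}` in `b_β` enters `log b_β` only through `A K ζ` and `log ρ`. -/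
theorem abs_log_div_le {κ ρ A K Z t : ℝ} (hκ : 0 < κ) (hρ : 0 < ρ) (hA : 1 ≤ A) (hK : 1 ≤ K)
    (hZ : 1 ≤ Z) (ht : 0 ≤ t) (hlog : |Real.log κ| ≤ K * Z) :
    |Real.log ((κ * ρ) ^ 2 * ρ * Real.exp (-t) / (A ^ 6 * K ^ 4 * Z))| + 1
      ≤ A * K * Z * (14 + 3 * |Real.log ρ| + t) := by
  have hA0 : 0 < A := by linarith
  have hK0 : 0 < K := by linarith
  have hZ0 : 0 < Z := by linarith
  have heq : Real.log ((κ * ρ) ^ 2 * ρ * Real.exp (-t) / (A ^ 6 * K ^ 4 * Z))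
      = 2 * Real.log κ + 3 * Real.log ρ - t
        - (6 * Real.log A + 4 * Real.log K + Real.log Z) := by
    rw [Real.log_div (by positivity) (by positivity), Real.log_mul (by positivity) (by positivity),
      Real.log_mul (by positivity) (by positivity), Real.log_pow,
      Real.log_mul (by positivity) (by positivity), Real.log_exp,
      Real.log_mul (by positivity) (by positivity), Real.log_mul (by positivity) (by positivity),
      Real.log_pow, Real.log_pow]
    push_cast
    ring
  have hlA := Real.log_le_sub_one_of_pos hA0
  have hlK := Real.log_le_sub_one_of_pos hK0
  have hlZ := Real.log_le_sub_one_of_pos hZ0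
  have hlA' := Real.log_nonneg hA
  have hlK' := Real.log_nonneg hK
  have hlZ' := Real.log_nonneg hZ
  have hAK : 1 ≤ A * K := one_le_mul_of_one_le_of_one_le hA hK
  have hKZ : 1 ≤ K * Z := one_le_mul_of_one_le_of_one_le hK hZ
  have hAZ : 1 ≤ A * Z := one_le_mul_of_one_le_of_one_le hA hZ
  have h1 : A ≤ A * K * Z := by nlinarith
  have h2 : K ≤ A * K * Z := by nlinarith
  have h3 : Z ≤ A * K * Z := by nlinarith
  have h4 : K * Z ≤ A * K * Z := by nlinarith
  have h5 : 3 * |Real.log ρ| + t ≤ A * K * Z * (3 * |Real.log ρ| + t) :=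
    le_mul_of_one_le_left (by positivity) (hA.trans h1)
  have habs : |Real.log ((κ * ρ) ^ 2 * ρ * Real.exp (-t) / (A ^ 6 * K ^ 4 * Z))|
      ≤ 2 * |Real.log κ| + 3 * |Real.log ρ| + t
        + (6 * Real.log A + 4 * Real.log K + Real.log Z) := by
    have := abs_le.mp (le_refl |Real.log κ|)
    have := abs_le.mp (le_refl |Real.log ρ|)
    rw [heq, abs_le]
    constructor <;> linarith
  linarith

/-- Cancellation of the powers of `A`, `K` and `κρ` in `b · T D (T D + 1)`. -/
theorem mul_mul_add_one_le {M A K Z κ ρ D e : ℝ} (hM : 0 < M) (hA : 1 ≤ A) (hK : 1 ≤ K)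
    (hZ : 1 ≤ Z) (hκ : 0 < κ) (hρ : 0 < ρ) (hκK : κ ≤ K) (hρD : ρ ≤ D) (he : 0 < e) :
    (κ * ρ) ^ 2 * ρ * e / (A ^ 6 * K ^ 4 * Z) * (M * A ^ 2 * K / (κ * ρ) * D)
        * (M * A ^ 2 * K / (κ * ρ) * D + 1)
      ≤ ρ * e * (M * (M + 1)) * D ^ 2 / (A ^ 2 * K ^ 2 * Z) := by
  have hA0 : 0 < A := by linarith
  have hK0 : 0 < K := by linarith
  have hZ0 : 0 < Z := by linarith
  have hD0 : 0 < D := by linarith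
  have hu : κ * ρ ≤ A ^ 2 * K * D := by
    calc κ * ρ ≤ K * D := by gcongr
      _ = 1 * (K * D) := by ring
      _ ≤ A ^ 2 * (K * D) := by gcongr; exact one_le_pow₀ hA
      _ = A ^ 2 * K * D := by ring
  calc _ = ρ * e * M * D * (M * A ^ 2 * K * D + κ * ρ) / (A ^ 4 * K ^ 3 * Z) := by field_simp
    _ ≤ ρ * e * M * D * (M * A ^ 2 * K * D + A ^ 2 * K * D) / (A ^ 4 * K ^ 3 * Z) := by gcongr
    _ = _ := by field_simp

theorem paperD_le {η₀ ρ : ℝ} (hρ : 0 < ρ) : paperD η₀ ρ ≤ 2 * Real.exp ((η₀ + 3) * ρ) := by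
  have h : 1 + √(2 * ρ) ≤ 2 * Real.exp ρ := by
    nlinarith [Real.add_one_le_exp ρ, Real.sq_sqrt (by positivity : 0 ≤ 2 * ρ),
      sq_nonneg (√(2 * ρ) - 1)]
  calc paperD η₀ ρ ≤ 2 * Real.exp ρ * Real.exp ((η₀ + 2) * ρ) := by
        unfold paperD; gcongr
    _ = 2 * Real.exp ((η₀ + 3) * ρ) := by
        rw [mul_assoc, ← Real.exp_add]; ring_nf

theorem self_le_paperD {η₀ ρ : ℝ} (hη : 0 < η₀) (hρ : 0 < ρ) : ρ ≤ paperD η₀ ρ := by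
  have h1 : (η₀ + 2) * ρ + 1 ≤ Real.exp ((η₀ + 2) * ρ) := Real.add_one_le_exp _
  have h2 : ρ ≤ Real.exp ((η₀ + 2) * ρ) := by nlinarith [mul_pos hη hρ]
  unfold paperD
  nlinarith [mul_nonneg (Real.sqrt_nonneg (2 * ρ)) (hρ.le.trans h2)]

theorem mul_log_factor_le {C₅ ρ t : ℝ} (hC : 0 < C₅) (hρ : 0 < ρ) (ht : 0 ≤ t) :
    ρ * (3 + 2 * ρ + C₅ * √ρ * Real.exp ρ + (14 + 3 * |Real.log ρ| + t))
      ≤ (25 + C₅) * Real.exp (2 * ρ) * (√ρ + ρ * t) := by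
  have hs := Real.sqrt_nonneg ρ
  have hss : √ρ * √ρ = ρ := Real.mul_self_sqrt hρ.le
  have hsE := sqrt_le_exp_self hρ.le
  have hρE : ρ + 1 ≤ Real.exp ρ := Real.add_one_le_exp ρ
  have hEE : Real.exp (2 * ρ) = Real.exp ρ * Real.exp ρ := by
    rw [← Real.exp_add]; ring_nf
  set E := Real.exp ρ
  have hE : 1 ≤ E := by linarith
  have h0 : E ≤ E * E := by nlinarith
  have h1 : √ρ ≤ E * E := hsE.trans h0
  have h2 : √ρ * ρ ≤ E * E := by gcongr; linarith
  have h3 : C₅ * (ρ * E) ≤ C₅ * (E * E) := by gcongr; linarith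
  have h4 : √ρ * |Real.log ρ| ≤ 2 * (E * E) := by
    linarith [sqrt_mul_abs_log_le hρ]
  have h5 : ρ * t ≤ (25 + C₅) * (E * E) * (ρ * t) := by
    apply le_mul_of_one_le_left (by positivity)
    nlinarith
  have h6 : √ρ * (17 * √ρ + 2 * (√ρ * ρ) + C₅ * (ρ * E) + 3 * (√ρ * |Real.log ρ|))
      ≤ √ρ * ((25 + C₅) * (E * E)) := by
    gcongr
    linarith
  have h7 : ρ * (3 + 2 * ρ + C₅ * √ρ * E + (14 + 3 * |Real.log ρ| + t))
      = √ρ * (17 * √ρ + 2 * (√ρ * ρ) + C₅ * (ρ * E) + 3 * (√ρ * |Real.log ρ|)) + ρ * t := by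
    linear_combination (-17 - 2 * ρ - 3 * |Real.log ρ|) * hss
  rw [h7, hEE]
  linarith

theorem sqrt_add_mul_exp_le {β ρ : ℝ} (hβ : 1 ≤ β) (hρ : 0 < ρ) :
    √β * ((√ρ + ρ * (β * ρ)) * Real.exp (-(β * ρ / 2))) ≤ 9 := by
  have hβ0 : 0 < β := by linarith
  set x := β * ρ with hx
  have hx0 : 0 < x := by positivity
  have hsx : √β * √ρ = √x := (Real.sqrt_mul hβ0.le ρ).symm
  have hE := Real.quadratic_le_exp_of_nonneg (by positivity : 0 ≤ x / 2)
  have h1 : √x ≤ Real.exp (x / 2) := by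
    nlinarith [Real.sq_sqrt hx0.le, sq_nonneg (√x - 1)]
  have h2 : √β * (ρ * x) ≤ 8 * Real.exp (x / 2) := by
    have hsβ : √β ≤ β := Real.sqrt_le_iff.mpr ⟨hβ0.le, le_self_pow₀ hβ two_ne_zero⟩
    calc √β * (ρ * x) ≤ β * (ρ * x) := by gcongr
      _ = x ^ 2 := by rw [hx]; ring
      _ ≤ 8 * Real.exp (x / 2) := by nlinarith
  calc √β * ((√ρ + ρ * x) * Real.exp (-(x / 2)))
      = (√β * √ρ + √β * (ρ * x)) * Real.exp (-(x / 2)) := by ring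
    _ ≤ (9 * Real.exp (x / 2)) * Real.exp (-(x / 2)) := by
        gcongr
        rw [hsx]
        linarith
    _ = 9 := by rw [mul_assoc, ← Real.exp_add]; simp

theorem paperXi_paperB_le {C₁ C₅ η₀ β α c₃ c₄ L κ₀ ρ : ℝ} (hC₁ : 0 < C₁) (hC₅ : 0 < C₅)
    (hη₀ : 0 < η₀) (hβ : 0 < β) (hα : 0 < α) (hc₃ : 0 < c₃) (hc₄ : 0 < c₄)
    (hκ : 0 < κ₀) (hρ : 0 < ρ) :
    paperXi C₁ C₅ η₀ α c₃ c₄ L κ₀ ρ (paperB α c₃ c₄ L κ₀ ρ β)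
      ≤ C₁⁻¹ * (C₁⁻¹ + 1) * paperD η₀ ρ ^ 2 * Real.exp (-(β * ρ))
        * (ρ * (3 + 2 * ρ + C₅ * √ρ * Real.exp ρ + (14 + 3 * |Real.log ρ| + β * ρ))) := by
  have hM : 0 < C₁⁻¹ := inv_pos.mpr hC₁
  have hZ := one_le_paperZeta hκ
  have hlogκ := abs_log_le_paperZeta hκ
  have hρD := self_le_paperD hη₀ hρ
  have hc5a : 2 * c₄ ≤ paperC5 c₃ c₄ L := le_max_left _ _
  have hc5b : c₃ + c₄ * Real.log (max 1 L) ≤ paperC5 c₃ c₄ L := le_max_right _ _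
  have hl : 0 ≤ Real.log (max 1 L) := Real.log_nonneg (le_max_left _ _)
  set A := α * paperC5 c₃ c₄ L + 1 with hAdef
  set K := κ₀ ^ 2 + 1 with hKdef
  set Z := paperZeta κ₀
  set D := paperD η₀ ρ
  have hA : 1 ≤ A := by nlinarith
  have hK : 1 ≤ K := by nlinarith
  have hκK : κ₀ ≤ K := by nlinarith [sq_nonneg (κ₀ - 1)]
  have hαc : α * c₄ ≤ A := by nlinarith [mul_pos hα hc₄]
  have hαl : α * (c₃ + c₄ * Real.log (max 1 L)) ≤ A := by nlinarith
  have hb : paperB α c₃ c₄ L κ₀ ρ β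
      = (κ₀ * ρ) ^ 2 * ρ * Real.exp (-(β * ρ)) / (A ^ 6 * K ^ 4 * Z) := by
    simp only [paperB, neg_mul]; rfl
  have hT : paperT C₁ α c₃ c₄ L κ₀ ρ = C₁⁻¹ * A ^ 2 * K / (κ₀ * ρ) := by
    rw [paperT, mul_comm (paperC5 c₃ c₄ L) α]
  have hlogb := abs_log_div_le hκ hρ hA hK hZ (by positivity : 0 ≤ β * ρ) hlogκ
  have hmain := mul_mul_add_one_le hM hA hK hZ hκ hρ hκK hρD (Real.exp_pos (-(β * ρ)))
  rw [← hb] at hlogb hmain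
  rw [← hT] at hmain
  set b := paperB α c₃ c₄ L κ₀ ρ β
  set T := paperT C₁ α c₃ c₄ L κ₀ ρ
  have hAK : 1 ≤ A * K := one_le_mul_of_one_le_of_one_le hA hK
  have hS : paperS C₅ α c₃ c₄ L κ₀ ρ ≤ A * K * (3 + 2 * ρ + C₅ * √ρ * Real.exp ρ) := by
    have e1 : 2 * κ₀ ^ 2 * (ρ / κ₀ + 1) = 2 * (κ₀ * ρ) + 2 * κ₀ ^ 2 := by field_simp
    have e2 : C₅ * √ρ * Real.exp ρ ≤ A * K * (C₅ * √ρ * Real.exp ρ) :=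
      le_mul_of_one_le_left (by positivity) hAK
    have hKA : K ≤ A * K := le_mul_of_one_le_left (by linarith) hA
    have hAA : A ≤ A * K := le_mul_of_one_le_right (by linarith) hK
    have e3 : κ₀ * ρ ≤ A * K * ρ := by gcongr; linarith
    rw [paperS, e1]
    linarith
  have hQ : paperS C₅ α c₃ c₄ L κ₀ ρ + α * c₄ * (|Real.log b| + 1)
      ≤ A ^ 2 * K ^ 2 * Z
        * (3 + 2 * ρ + C₅ * √ρ * Real.exp ρ + (14 + 3 * |Real.log ρ| + β * ρ)) := by
    have hA0 : 0 < A := by linarith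
    have hK0 : 0 < K := by linarith
    have e1 : A * K * (3 + 2 * ρ + C₅ * √ρ * Real.exp ρ)
        ≤ A ^ 2 * K ^ 2 * Z * (3 + 2 * ρ + C₅ * √ρ * Real.exp ρ) := by
      refine mul_le_mul_of_nonneg_right ?_ (by positivity)
      calc A * K = A * K * 1 * 1 := by ring
        _ ≤ A * K * (A * K) * Z := by gcongr
        _ = A ^ 2 * K ^ 2 * Z := by ring
    have e2 : α * c₄ * (|Real.log b| + 1)
        ≤ A ^ 2 * K ^ 2 * Z * (14 + 3 * |Real.log ρ| + β * ρ) := by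
      calc α * c₄ * (|Real.log b| + 1)
          ≤ A * (A * K * Z * (14 + 3 * |Real.log ρ| + β * ρ)) := by gcongr
        _ = A ^ 2 * K * Z * (14 + 3 * |Real.log ρ| + β * ρ) := by ring
        _ ≤ A ^ 2 * K ^ 2 * Z * (14 + 3 * |Real.log ρ| + β * ρ) := by
          gcongr
          exact le_self_pow₀ hK two_ne_zero
    linarith
  have hA0 : 0 < A := by linarith
  have hK0 : 0 < K := by linarith
  have hZ0 : 0 < Z := by linarith
  have hQ0 : 0 ≤ paperS C₅ α c₃ c₄ L κ₀ ρ + α * c₄ * (|Real.log b| + 1) := by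
    unfold paperS; positivity
  calc paperXi C₁ C₅ η₀ α c₃ c₄ L κ₀ ρ b
      = b * (T * D) * (T * D + 1)
        * (paperS C₅ α c₃ c₄ L κ₀ ρ + α * c₄ * (|Real.log b| + 1)) := by
        unfold paperXi; ring
    _ ≤ ρ * Real.exp (-(β * ρ)) * (C₁⁻¹ * (C₁⁻¹ + 1)) * D ^ 2 / (A ^ 2 * K ^ 2 * Z)
        * (A ^ 2 * K ^ 2 * Z
          * (3 + 2 * ρ + C₅ * √ρ * Real.exp ρ + (14 + 3 * |Real.log ρ| + β * ρ))) := by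
        gcongr
    _ = _ := by field_simp

/-- Corollary A.2 of the paper: there is `β₀ > 0` depending only on `C₁, C₅, η₀` such
that for all `β ≥ β₀` one has `ξ(b_β) ≤ 1/4`, uniformly in the remaining parameters. -/
theorem xi_le_quarter
    (C₁ C₅ η₀ : ℝ) (hC₁ : 0 < C₁) (hC₅ : 0 < C₅) (hη₀ : 0 < η₀) :
    ∃ β₀ > (0:ℝ),
      ∀ β : ℝ, β₀ ≤ β →
        ∀ α c₃ c₄ L κ₀ ρ : ℝ,
          0 < α → 0 < c₃ → 0 < c₄ → 0 < L → 0 < κ₀ → 0 < ρ →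
          paperXi C₁ C₅ η₀ α c₃ c₄ L κ₀ ρ (paperB α c₃ c₄ L κ₀ ρ β) ≤ 1 / 4 := by
  set G : ℝ := 4 * (C₁⁻¹ * (C₁⁻¹ + 1)) * (25 + C₅) with hG
  have hG0 : 0 < G := by positivity
  refine ⟨1 + 4 * (η₀ + 4) + (36 * G) ^ 2, by positivity, ?_⟩
  intro β hβ α c₃ c₄ L κ₀ ρ hα hc₃ hc₄ _ hκ hρ
  have hβ1 : 1 ≤ β := by nlinarith [sq_nonneg (36 * G)]
  have hβη : 4 * (η₀ + 4) ≤ β := by nlinarith [sq_nonneg (36 * G)]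
  have hβ0 : 0 < β := by linarith
  have hβG : 36 * G ≤ √β := Real.le_sqrt_of_sq_le (by linarith)
  have hD0 : 0 ≤ paperD η₀ ρ := hρ.le.trans (self_le_paperD hη₀ hρ)
  have hexp : Real.exp ((η₀ + 3) * ρ) ^ 2 * Real.exp (-(β * ρ)) * Real.exp (2 * ρ)
      ≤ Real.exp (-(β * ρ / 2)) := by
    rw [← Real.exp_nat_mul, ← Real.exp_add, ← Real.exp_add]
    apply Real.exp_le_exp.mpr
    push_cast
    nlinarith
  have hY := sqrt_add_mul_exp_le hβ1 hρ
  set Y := (√ρ + ρ * (β * ρ)) * Real.exp (-(β * ρ / 2)) with hYdef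
  have hY0 : 0 ≤ Y := by positivity
  calc _ ≤ _ := paperXi_paperB_le hC₁ hC₅ hη₀ hβ0 hα hc₃ hc₄ hκ hρ
    _ ≤ C₁⁻¹ * (C₁⁻¹ + 1) * (2 * Real.exp ((η₀ + 3) * ρ)) ^ 2 * Real.exp (-(β * ρ))
        * ((25 + C₅) * Real.exp (2 * ρ) * (√ρ + ρ * (β * ρ))) := by
        refine mul_le_mul ?_ (mul_log_factor_le hC₅ hρ (by positivity)) (by positivity)
          (by positivity)
        gcongr
        exact paperD_le hρ
    _ = G * ((√ρ + ρ * (β * ρ))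
        * (Real.exp ((η₀ + 3) * ρ) ^ 2 * Real.exp (-(β * ρ)) * Real.exp (2 * ρ))) := by
        rw [hG]; ring
    _ ≤ G * Y := by rw [hYdef]; gcongr
    _ ≤ 1 / 4 := by nlinarith [mul_le_mul_of_nonneg_right hβG hY0]
end
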